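/- arXiv:2304.04837 — 2 statements merged into one kernel-verified Lean document; each statement's English description precedes it below -/
import Mathlib

section
/- Let d ∈ ℕ, ε ∈ [0, ∞), and k ∈ ℕ with k ≤ 2^d. If 𝒫 is a (k, ε)-secluded partition of ℝ^d such that every member of 𝒫 has outer Lebesgue measure at most 1, then ε ≤ (ln k)/d. -/
open MeasureTheory
open scoped NNReal ENNReal

/-- Weighted AM-GM with weights `(1 + 2r)⁻¹` and `2r / (1 + 2r)`. -/
theorem NNReal.mul_rpow_le_mul_rpow_add {r p : ℝ≥0} (hp : p * (1 + 2 * r) = 1) (a m : ℝ≥0)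
    (hm : m ≠ 0) :
    (1 + 2 * r) * a ^ (p : ℝ) ≤ a * m ^ ((p : ℝ) - 1) + 2 * r * m ^ (p : ℝ) := by
  have hw : p + p * (2 * r) = 1 := by rw [← hp]; ring
  have hw' : ((p * (2 * r) : ℝ≥0) : ℝ) = 1 - p := by
    have := congrArg NNReal.toReal hw
    push_cast at this ⊢
    linarith
  have h := NNReal.geom_mean_le_arith_mean2_weighted p (p * (2 * r)) (a * m ^ ((p : ℝ) - 1))
    (m ^ (p : ℝ)) hw
  have hprod : (a * m ^ ((p : ℝ) - 1)) ^ (p : ℝ) * (m ^ (p : ℝ)) ^ ((p * (2 * r) : ℝ≥0) : ℝ)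
      = a ^ (p : ℝ) := by
    rw [hw', NNReal.mul_rpow, ← NNReal.rpow_mul, ← NNReal.rpow_mul, mul_assoc,
      ← NNReal.rpow_add hm]
    ring_nf
    simp
  rw [hprod] at h
  calc (1 + 2 * r) * a ^ (p : ℝ)
      ≤ (1 + 2 * r) * (p * (a * m ^ ((p : ℝ) - 1)) + p * (2 * r) * m ^ (p : ℝ)) := by gcongr
    _ = (p * (1 + 2 * r)) * (a * m ^ ((p : ℝ) - 1) + 2 * r * m ^ (p : ℝ)) := by ring
    _ = _ := by rw [hp, one_mul]

/-- If `h` dominates `g` on windows of radius `r`, then its integral exceeds that of `g` by at least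
`2r` times any value of `g`. -/
theorem lintegral_add_mul_le_of_window {r : ℝ≥0} {g h : ℝ → ℝ≥0∞}
    (hgh : ∀ x y : ℝ, |x - y| ≤ r → g x ≤ h y) (t : ℝ) :
    (∫⁻ x, g x) + 2 * r * g t ≤ ∫⁻ x, h x := by
  have hr : (0 : ℝ) ≤ r := r.2
  have hleft : ∫⁻ x in Set.Iio t, g x ≤ ∫⁻ x in Set.Iio (t - r), h x := by
    rw [← lintegral_indicator measurableSet_Iio, ← lintegral_indicator measurableSet_Iio,
      ← lintegral_add_right_eq_self _ (r : ℝ)]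
    refine lintegral_mono fun x => ?_
    by_cases hx : x + r < t
    · rw [Set.indicator_of_mem (by exact hx), Set.indicator_of_mem (by simp; linarith)]
      exact hgh _ _ (by simp)
    · rw [Set.indicator_of_notMem (by exact hx)]; exact zero_le
  have hright : ∫⁻ x in Set.Ici t, g x ≤ ∫⁻ x in Set.Ioi (t + r), h x := by
    rw [setLIntegral_congr Ioi_ae_eq_Ici.symm, ← lintegral_indicator measurableSet_Ioi,
      ← lintegral_indicator measurableSet_Ioi, ← lintegral_add_right_eq_self _ (-r : ℝ)]
    refine lintegral_mono fun x => ?_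
    by_cases hx : t < x + -r
    · rw [Set.indicator_of_mem (by exact hx), Set.indicator_of_mem (by simp; linarith)]
      exact hgh _ _ (by simp)
    · rw [Set.indicator_of_notMem (by exact hx)]; exact zero_le
  have hmid : 2 * r * g t ≤ ∫⁻ x in Set.Icc (t - r) (t + r), h x := by
    calc 2 * r * g t = ∫⁻ x in Set.Icc (t - r) (t + r), g t := by
          rw [setLIntegral_const, Real.volume_Icc, mul_comm]
          congr 1
          rw [show t + r - (t - r) = ((2 * r : ℝ≥0) : ℝ) by push_cast; ring,
            ENNReal.ofReal_coe_nnreal]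
          push_cast; rfl
      _ ≤ _ := setLIntegral_mono' measurableSet_Icc fun x hx => hgh _ _ (by
          rw [abs_le]; constructor <;> linarith [hx.1, hx.2])
  have hsplit : ∫⁻ x, h x = (∫⁻ x in Set.Iio (t - r), h x) +
      ((∫⁻ x in Set.Icc (t - r) (t + r), h x) + ∫⁻ x in Set.Ioi (t + r), h x) := by
    rw [← lintegral_add_compl h (measurableSet_Iio (a := t - r)), Set.compl_Iio,
      ← Set.Icc_union_Ioi_eq_Ici (show t - (r : ℝ) ≤ t + r by linarith),
      lintegral_union measurableSet_Ioi]
    exact Set.disjoint_left.2 fun x hx hx' => not_lt.2 hx.2 hx'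
  rw [hsplit, ← lintegral_add_compl g (measurableSet_Iio (a := t)), Set.compl_Iio,
    add_assoc, add_comm (∫⁻ x in Set.Ici t, g x)]
  gcongr

/-- One-dimensional Prékopa–Leindler inequality for an interval of length `2r`. -/
theorem mul_lintegral_rpow_le_of_window {r p : ℝ≥0} (hr : 0 < r) (hp : p * (1 + 2 * r) = 1)
    {f h : ℝ → ℝ≥0∞} (hf : Measurable f) (hfh : ∀ x y : ℝ, |x - y| ≤ r → f x ^ (p : ℝ) ≤ h y) :
    (1 + 2 * r) * (∫⁻ x, f x) ^ (p : ℝ) ≤ ∫⁻ x, h x := by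
  have hp0 : 0 < p := pos_of_mul_pos_left (by rw [hp]; exact one_pos) zero_le
  have hp0' : (0 : ℝ) < p := hp0
  set M := ⨆ x, f x
  have key : (∫⁻ x, f x ^ (p : ℝ)) + 2 * r * M ^ (p : ℝ) ≤ ∫⁻ x, h x := by
    have : M ^ (p : ℝ) = ⨆ x, f x ^ (p : ℝ) := (ENNReal.orderIsoRpow p hp0').map_iSup f
    rw [this, ENNReal.mul_iSup, ENNReal.add_iSup]
    exact iSup_le fun t => lintegral_add_mul_le_of_window hfh t
  have hfM : ∀ x, f x ≤ M := le_iSup f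
  by_cases hM0 : M = 0
  · have : ∀ x, f x = 0 := fun x => le_antisymm (hM0 ▸ hfM x) zero_le
    simp [this, hp0']
  by_cases hMt : M = ⊤
  · rw [hMt, ENNReal.top_rpow_of_pos hp0', ENNReal.mul_top (by simp [hr.ne']), add_top,
      top_le_iff] at key
    rw [key]; exact le_top
  have hlow : (∫⁻ x, f x) * M ^ ((p : ℝ) - 1) ≤ ∫⁻ x, f x ^ (p : ℝ) := by
    rw [← lintegral_mul_const _ hf]
    refine lintegral_mono fun x => ?_
    by_cases hx : f x = 0
    · simp [hx]
    have hxt : f x ≠ ⊤ := ne_top_of_le_ne_top hMt (hfM x)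
    calc f x * M ^ ((p : ℝ) - 1) ≤ f x * f x ^ ((p : ℝ) - 1) := by
          have hp1 : p ≤ 1 := by rw [← hp]; exact le_mul_of_one_le_right zero_le (by simp)
          have hp1' : 0 ≤ 1 - (p : ℝ) := sub_nonneg.2 hp1
          rw [← neg_sub, ENNReal.rpow_neg, ENNReal.rpow_neg]
          gcongr
          exact hfM x
      _ = f x ^ (p : ℝ) := by
          nth_rw 1 [← ENNReal.rpow_one (f x)]
          rw [← ENNReal.rpow_add _ _ hx hxt]; ring_nf
  refine le_trans ?_ ((add_le_add_left hlow _).trans key)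
  generalize (∫⁻ x, f x) = I
  clear_value M
  by_cases hI : I = ⊤
  · rw [hI, ENNReal.top_mul, top_add]
    · exact le_top
    · simp [ENNReal.rpow_eq_zero_iff, hM0, hMt]
  lift I to ℝ≥0 using hI
  lift M to ℝ≥0 using hMt
  have hM0' : M ≠ 0 := by simpa using hM0
  rw [← ENNReal.coe_rpow_of_nonneg _ hp0'.le, ← ENNReal.coe_rpow_of_nonneg _ hp0'.le,
    ← ENNReal.coe_rpow_of_ne_zero hM0']
  exact_mod_cast NNReal.mul_rpow_le_mul_rpow_add hp I M hM0'

/-- Prékopa–Leindler inequality for a cube of side length `2r`. -/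
theorem pow_mul_lintegral_rpow_le_of_window {r p : ℝ≥0} (hr : 0 < r) (hp : p * (1 + 2 * r) = 1)
    (d : ℕ) {f h : (Fin d → ℝ) → ℝ≥0∞} (hf : Measurable f) (hh : Measurable h)
    (hfh : ∀ x y : Fin d → ℝ, (∀ i, |x i - y i| ≤ r) → f x ^ (p : ℝ) ≤ h y) :
    (1 + 2 * r) ^ d * (∫⁻ x, f x) ^ (p : ℝ) ≤ ∫⁻ x, h x := by
  induction d with
  | zero =>
    have : (volume : Measure (Fin 0 → ℝ)) Set.univ = 1 := by simp [volume_pi]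
    rw [lintegral_unique, lintegral_unique, this]
    rw [pow_zero, one_mul, mul_one, mul_one]
    exact hfh _ _ (by simp)
  | succ n ih =>
    have fubini : ∀ {u : (Fin (n + 1) → ℝ) → ℝ≥0∞}, Measurable u →
        Measurable (fun q : ℝ × (Fin n → ℝ) => u (Fin.cons q.1 q.2)) ∧
        ∫⁻ x, u x = ∫⁻ t : ℝ, ∫⁻ x : Fin n → ℝ, u (Fin.cons t x) := by
      intro u hu
      let e := MeasurableEquiv.piFinSuccAbove (fun _ : Fin (n + 1) => ℝ) 0
      have he : ∀ q, e.symm q = Fin.cons q.1 q.2 := fun q => by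
        simp [e, MeasurableEquiv.piFinSuccAbove, Fin.insertNthEquiv]
      have hm : Measurable (fun q : ℝ × (Fin n → ℝ) => u (Fin.cons q.1 q.2)) := by
        simpa only [Function.comp_def, he] using hu.comp e.symm.measurable
      refine ⟨hm, ?_⟩
      rw [← lintegral_prod _ hm.aemeasurable]
      have := ((volume_preserving_piFinSuccAbove (fun _ : Fin (n + 1) => ℝ) 0).symm).lintegral_comp
        hu
      rw [← this]
      exact lintegral_congr fun q => congrArg u (he q)
    obtain ⟨hfm, hfi⟩ := fubini hf
    obtain ⟨hhm, hhi⟩ := fubini hh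
    rw [hfi, hhi]
    have hc0 : (1 + 2 * r : ℝ≥0∞) ^ n ≠ 0 := by simp
    have hct : (1 + 2 * r : ℝ≥0∞) ^ n ≠ ⊤ := by
      exact ENNReal.pow_ne_top (by exact_mod_cast ENNReal.coe_ne_top (r := 1 + 2 * r))
    have hmul := mul_lintegral_rpow_le_of_window (r := r) (p := p) hr hp
      (f := fun t => ∫⁻ x : Fin n → ℝ, f (Fin.cons t x))
      (h := fun t => ((1 + 2 * r : ℝ≥0∞) ^ n)⁻¹ * ∫⁻ x : Fin n → ℝ, h (Fin.cons t x))
      hfm.lintegral_prod_right' (fun s t hst => by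
        rw [mul_comm, ← div_eq_mul_inv, ENNReal.le_div_iff_mul_le (Or.inl hc0) (Or.inl hct),
          mul_comm]
        refine ih (hfm.comp measurable_prodMk_left) (hhm.comp measurable_prodMk_left)
          fun x y hxy => hfh _ _ fun i => ?_
        refine Fin.cases ?_ (fun j => ?_) i
        · simpa using hst
        · simpa using hxy j)
    rw [lintegral_const_mul _ hhm.lintegral_prod_right', mul_comm _ (lintegral _ _),
      ← div_eq_mul_inv, ENNReal.le_div_iff_mul_le (Or.inl hc0) (Or.inl hct)] at hmul
    rw [pow_succ]
    calc _ = _ := by ring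
      _ ≤ _ := hmul

/-- Lower bound on the volume of a thickening of a set of volume at most `1`. -/
theorem pow_mul_volume_le_volume_thickening {d : ℕ} {r : ℝ≥0} (hr : 0 < r) {ε : ℝ} (hε : r < ε)
    {X : Set (Fin d → ℝ)} (hX : volume X ≤ 1) :
    (1 + 2 * r) ^ d * volume X ≤ volume (Metric.thickening ε X) := by
  set U := Metric.thickening (ε - r) X
  obtain ⟨p, hp⟩ : ∃ p : ℝ≥0, p * (1 + 2 * r) = 1 := ⟨_, inv_mul_cancel₀ (by positivity)⟩
  have hp0 : 0 < p := pos_of_mul_pos_left (by rw [hp]; exact one_pos) zero_le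
  have hp1 : p ≤ 1 := by rw [← hp]; exact le_mul_of_one_le_right zero_le (by simp)
  have hUm : MeasurableSet U := Metric.isOpen_thickening.measurableSet
  have hVm : MeasurableSet (Metric.thickening ε X) := Metric.isOpen_thickening.measurableSet
  have h := pow_mul_lintegral_rpow_le_of_window hr hp d (f := U.indicator 1)
    (h := (Metric.thickening ε X).indicator 1) (measurable_one.indicator hUm)
    (measurable_one.indicator hVm) (fun x y hxy => by
      by_cases hx : x ∈ U
      · have hy : y ∈ Metric.thickening ε X := by
          obtain ⟨z, hz, hxz⟩ := Metric.mem_thickening_iff.1 hx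
          refine Metric.mem_thickening_iff.2 ⟨z, hz, ?_⟩
          have : dist x y ≤ r := (dist_pi_le_iff r.2).2 hxy
          linarith [dist_triangle y x z, dist_comm x y]
        simp [hx, hy]
      · simp [hx, hp0])
  rw [lintegral_indicator_one hUm, lintegral_indicator_one hVm] at h
  refine le_trans ?_ h
  gcongr
  calc volume X = volume X ^ (1 : ℝ) := (ENNReal.rpow_one _).symm
    _ ≤ volume X ^ (p : ℝ) := ENNReal.rpow_le_rpow_of_exponent_ge hX hp1
    _ ≤ _ := by
      gcongr
      exact Metric.self_subset_thickening (by linarith) X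

/-- In a partition of a separable space, if every ball of a fixed positive radius meets only
finitely many members, then there are only countably many members. -/
theorem Setoid.IsPartition.countable_of_encard_le {E : Type*} [PseudoMetricSpace E]
    [TopologicalSpace.SeparableSpace E] {P : Set (Set E)} (hP : Setoid.IsPartition P) {ε : ℝ}
    (hε : 0 < ε) {k : ℕ}
    (hsec : ∀ p : E, {X ∈ P | (X ∩ Metric.closedBall p ε).Nonempty}.encard ≤ (k : ℕ∞)) :
    P.Countable := by
  obtain ⟨s, hsc, hsd⟩ := TopologicalSpace.exists_countable_dense E
  refine (hsc.biUnion (t := fun q _ => {X ∈ P | (X ∩ Metric.closedBall q ε).Nonempty})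
    fun q _ => (Set.finite_of_encard_le_coe (hsec q)).countable).mono fun X hX => ?_
  obtain ⟨x, hx⟩ := Setoid.nonempty_of_mem_partition hP hX
  obtain ⟨q, hq, hxq⟩ := hsd.exists_dist_lt x hε
  exact Set.mem_biUnion hq ⟨hX, x, hx, hxq.le⟩

/-- Averaging over a cube of half-width `R`. -/
theorem pow_mul_pow_le_of_secluded {d k : ℕ} {r : ℝ≥0} (hr : 0 < r) {ε : ℝ} (hε : r < ε)
    {P : Set (Set (Fin d → ℝ))} (hP : Setoid.IsPartition P) (hmeas : ∀ X ∈ P, volume X ≤ 1)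
    (hsec : ∀ p : Fin d → ℝ,
      {X ∈ P | (X ∩ Metric.closedBall p ε).Nonempty}.encard ≤ (k : ℕ∞)) {R : ℝ} (hR : 0 ≤ R) :
    (1 + 2 * (r : ℝ)) ^ d * (2 * R) ^ d ≤ k * (2 * (R + ε)) ^ d := by
  have hε0 : 0 < ε := lt_of_le_of_lt r.2 hε
  have : Countable P := (hP.countable_of_encard_le hε0 hsec).to_subtype
  let B : Set (Fin d → ℝ) := Metric.closedBall 0 R
  let B' : Set (Fin d → ℝ) := Metric.closedBall 0 (R + ε)
  let V : P → Set (Fin d → ℝ) := fun X => Metric.thickening ε (X ∩ B)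
  have hVm : ∀ X, MeasurableSet (V X) := fun X => Metric.isOpen_thickening.measurableSet
  have hcover : volume B ≤ ∑' X : P, volume ((X : Set (Fin d → ℝ)) ∩ B) := by
    refine (measure_mono fun x hx => ?_).trans (measure_iUnion_le _)
    obtain ⟨X, ⟨hX, hxX⟩, -⟩ := hP.2 x
    exact Set.mem_iUnion.2 ⟨⟨X, hX⟩, hxX, hx⟩
  have hcount : ∀ z, ∑' X : P, (V X).indicator (1 : (Fin d → ℝ) → ℝ≥0∞) z
      ≤ B'.indicator (fun _ => (k : ℝ≥0∞)) z := by
    intro z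
    by_cases hz : z ∈ B'
    · rw [Set.indicator_of_mem hz, ENNReal.tsum_eq_iSup_sum]
      refine iSup_le fun s => ?_
      classical
      have hs : ((s.filter fun X => z ∈ V X).card : ℕ∞) ≤ k := by
        refine le_trans ?_ (hsec z)
        rw [← Set.encard_coe_eq_coe_finsetCard, ← Subtype.val_injective.encard_image]
        refine Set.encard_le_encard ?_
        rintro _ ⟨X, hX, rfl⟩
        obtain ⟨x, hx, hzx⟩ := Metric.mem_thickening_iff.1 (Finset.mem_filter.1 hX).2
        exact ⟨X.2, x, hx.1, by rw [Metric.mem_closedBall, dist_comm]; exact hzx.le⟩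
      calc ∑ X ∈ s, (V X).indicator (1 : (Fin d → ℝ) → ℝ≥0∞) z
          = ((s.filter fun X => z ∈ V X).card : ℝ≥0∞) := by
            simp [Set.indicator_apply]
        _ ≤ k := by exact_mod_cast hs
    · rw [Set.indicator_of_notMem hz, nonpos_iff_eq_zero, ENNReal.tsum_eq_zero]
      intro X
      refine Set.indicator_of_notMem (fun hzV => hz ?_) _
      obtain ⟨x, hx, hzx⟩ := Metric.mem_thickening_iff.1 hzV
      have : dist x 0 ≤ R := hx.2
      exact Metric.mem_closedBall.2 (by linarith [dist_triangle z x 0])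
  have hmain : (1 + 2 * (r : ℝ≥0∞)) ^ d * volume B ≤ k * volume B' := by
    calc (1 + 2 * (r : ℝ≥0∞)) ^ d * volume B
        ≤ (1 + 2 * (r : ℝ≥0∞)) ^ d * ∑' X : P, volume ((X : Set (Fin d → ℝ)) ∩ B) := by gcongr
      _ = ∑' X : P, (1 + 2 * (r : ℝ≥0∞)) ^ d * volume ((X : Set (Fin d → ℝ)) ∩ B) :=
          ENNReal.tsum_mul_left.symm
      _ ≤ ∑' X : P, volume (V X) := ENNReal.tsum_le_tsum fun X =>
          pow_mul_volume_le_volume_thickening hr hε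
            ((measure_mono Set.inter_subset_left).trans (hmeas X X.2))
      _ = ∫⁻ z, ∑' X : P, (V X).indicator 1 z := by
          rw [lintegral_tsum fun X => (measurable_one.indicator (hVm X)).aemeasurable]
          exact tsum_congr fun X => (lintegral_indicator_one (hVm X)).symm
      _ ≤ ∫⁻ z, B'.indicator (fun _ => (k : ℝ≥0∞)) z := lintegral_mono hcount
      _ = k * volume B' := lintegral_indicator_const Metric.isClosed_closedBall.measurableSet _
  rw [Real.volume_pi_closedBall _ hR, Real.volume_pi_closedBall _ (by linarith),
    Fintype.card_fin] at hmain
  have hc : (1 + 2 * (r : ℝ≥0∞)) ^ d = ENNReal.ofReal ((1 + 2 * (r : ℝ)) ^ d) := by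
    rw [ENNReal.ofReal_pow (by positivity),
      show (1 + 2 * (r : ℝ)) = ((1 + 2 * r : ℝ≥0) : ℝ) by push_cast; rfl,
      ENNReal.ofReal_coe_nnreal]
    push_cast; rfl
  rw [hc, ← ENNReal.ofReal_natCast, ← ENNReal.ofReal_mul (by positivity),
    ← ENNReal.ofReal_mul (by positivity)] at hmain
  exact (ENNReal.ofReal_le_ofReal_iff (by positivity)).1 hmain

/-- The number of members met by a ball is at least the `d`-th power of `1 + 2r`. -/
theorem pow_le_of_secluded {d k : ℕ} {r : ℝ≥0} (hr : 0 < r) {ε : ℝ} (hε : r < ε)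
    {P : Set (Set (Fin d → ℝ))} (hP : Setoid.IsPartition P) (hmeas : ∀ X ∈ P, volume X ≤ 1)
    (hsec : ∀ p : Fin d → ℝ,
      {X ∈ P | (X ∩ Metric.closedBall p ε).Nonempty}.encard ≤ (k : ℕ∞)) :
    (1 + 2 * (r : ℝ)) ^ d ≤ k := by
  have hlim : Filter.Tendsto (fun R : ℝ => (k : ℝ) * (1 + ε * R⁻¹) ^ d) Filter.atTop
      (nhds (k * (1 + ε * 0) ^ d)) :=
    (((tendsto_inv_atTop_zero.const_mul ε).const_add 1).pow d).const_mul _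
  rw [mul_zero, add_zero, one_pow, mul_one] at hlim
  refine ge_of_tendsto hlim ?_
  filter_upwards [Filter.eventually_gt_atTop 0] with R hR
  have h := pow_mul_pow_le_of_secluded hr hε hP hmeas hsec hR.le
  have h2 : (2 * (R + ε)) ^ d = (1 + ε * R⁻¹) ^ d * (2 * R) ^ d := by
    rw [← mul_pow]; congr 1; field_simp
  rw [h2, ← mul_assoc] at h
  exact le_of_mul_le_mul_right h (by positivity)

/-- If `P` is a `(k, ε)`-secluded partition of `ℝ^d` (modeled as `Fin d → ℝ` with the ℓ∞ norm),
all members having outer Lebesgue measure at most `1`, and `k ≤ 2^d`, then `ε ≤ ln k / d`. -/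
theorem secluded_tolerance_upper_bound
    (d : ℕ) (hd : 0 < d) (ε : ℝ) (hε : 0 ≤ ε) (k : ℕ) (hk : k ≤ 2 ^ d)
    (P : Set (Set (Fin d → ℝ))) (hP : Setoid.IsPartition P)
    (hmeas : ∀ X ∈ P, volume X ≤ 1)
    (hsec : ∀ p : Fin d → ℝ,
      {X ∈ P | (X ∩ Metric.closedBall p ε).Nonempty}.encard ≤ (k : ℕ∞)) :
    ε ≤ Real.log k / d := by
  refine le_of_forall_lt_imp_le_of_dense fun r hrε => ?_
  rcases le_or_gt r 0 with hr | hr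
  · exact hr.trans (div_nonneg (Real.log_natCast_nonneg k) d.cast_nonneg)
  lift r to ℝ≥0 using hr.le
  have hpow := pow_le_of_secluded hr hrε hP hmeas hsec
  have hr2 : 1 + 2 * (r : ℝ) ≤ 2 :=
    le_of_pow_le_pow_left₀ hd.ne' (by norm_num) (hpow.trans (by exact_mod_cast hk))
  have hlog : (r : ℝ) ≤ Real.log (1 + 2 * r) := by
    refine le_trans ?_ (Real.one_sub_inv_le_log_of_pos (by positivity))
    rw [← sub_nonneg]
    have : 1 - (1 + 2 * (r : ℝ))⁻¹ - r = r * (1 - 2 * r) / (1 + 2 * r) := by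
      field_simp; ring
    rw [this]
    exact div_nonneg (mul_nonneg hr.le (by linarith)) (by positivity)
  rw [le_div_iff₀ (by exact_mod_cast hd), mul_comm]
  calc d * (r : ℝ) ≤ d * Real.log (1 + 2 * r) := by gcongr
    _ = Real.log ((1 + 2 * r) ^ d) := (Real.log_pow _ _).symm
    _ ≤ Real.log k := Real.log_le_log (by positivity) hpow
end

section
/- Let d ∈ ℕ, M ∈ (0, ∞), and let ℝ^d be equipped with an arbitrary norm ‖·‖. Let v denote the Lebesgue measure of the open unit ball {x ∈ ℝ^d : ‖x‖ < 1}. Let 𝒫 be a partition of ℝ^d such that every member of 𝒫 has outer Lebesgue measure at most M. Then for every ε ∈ (0, ∞) there exists p ∈ ℝ^d such that the open ball {x : ‖x − p‖ < ε} intersects at least ⌈(1 + ε · (v/M)^{1/d})^d⌉ members of 𝒫. -/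
open MeasureTheory

section

open scoped Pointwise ENNReal

/-- The one-dimensional Brunn–Minkowski inequality for compact sets. -/
theorem IsCompact.volume_add_volume_le_volume_add {A B : Set ℝ} (hA : IsCompact A)
    (hB : IsCompact B) (hA' : A.Nonempty) (hB' : B.Nonempty) :
    volume A + volume B ≤ volume (A + B) := by
  obtain ⟨a, ha, hamax⟩ := hA.exists_isGreatest hA'
  obtain ⟨b, hb, hbmin⟩ := hB.exists_isLeast hB'
  have h1 : volume ((fun x ↦ x + b) '' A) = volume A := by simp
  have h2 : volume ((fun x ↦ a + x) '' B) = volume B := by simp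
  have hm : MeasurableSet ((fun x ↦ a + x) '' B) :=
    (hB.image (by fun_prop)).measurableSet
  have hi : volume (((fun x ↦ x + b) '' A) ∩ ((fun x ↦ a + x) '' B)) = 0 := by
    refine measure_mono_null (t := {a + b}) ?_ (by simp)
    rintro _ ⟨⟨x, hx, rfl⟩, ⟨y, hy, hxy⟩⟩
    have := hamax hx
    have := hbmin hy
    simp only [Set.mem_singleton_iff] at *
    linarith
  have h := measure_union_add_inter (μ := volume) ((fun x ↦ x + b) '' A) hm
  rw [hi, add_zero, h1, h2] at h
  rw [← h]
  refine measure_mono ?_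
  rintro _ (⟨x, hx, rfl⟩ | ⟨x, hx, rfl⟩)
  exacts [Set.add_mem_add hx hb, Set.add_mem_add ha hx]

/-- The one-dimensional Brunn–Minkowski inequality for measurable sets. -/
theorem MeasurableSet.volume_add_volume_le_volume_add {A B : Set ℝ} (hA : MeasurableSet A)
    (hB : MeasurableSet B) (hA' : A.Nonempty) (hB' : B.Nonempty) :
    volume A + volume B ≤ volume (A + B) := by
  obtain ⟨a, ha⟩ := hA'
  obtain ⟨b, hb⟩ := hB'
  rw [hA.measure_eq_iSup_isCompact, hB.measure_eq_iSup_isCompact]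
  simp_rw [iSup_and']
  refine ENNReal.biSup_add_biSup_le' ⟨∅, by simp⟩ ⟨∅, by simp⟩ ?_
  rintro K ⟨hKA, hK⟩ L ⟨hLB, hL⟩
  calc volume K + volume L ≤ volume (insert a K) + volume (insert b L) := by
        gcongr <;> exact Set.subset_insert _ _
    _ ≤ volume (insert a K + insert b L) :=
        (hK.insert a).volume_add_volume_le_volume_add (hL.insert b) (by simp) (by simp)
    _ ≤ volume (A + B) := by
        gcongr
        exacts [Set.insert_subset ha hKA, Set.insert_subset hb hLB]

/-- The layer cake formula for functions bounded by one. -/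
theorem lintegral_eq_lintegral_meas_lt_of_le_one {α : Type*} [MeasurableSpace α] {μ : Measure α}
    {f : α → ℝ≥0∞} (hf : Measurable f) (hf1 : ∀ x, f x ≤ 1) :
    ∫⁻ x, f x ∂μ = ∫⁻ s in Set.Ioi (0 : ℝ), μ {x | ENNReal.ofReal s < f x} := by
  have hfin : ∀ x, f x ≠ ∞ := fun x ↦ ne_top_of_le_ne_top (by simp) (hf1 x)
  have h := lintegral_eq_lintegral_meas_lt (f := fun x ↦ (f x).toReal) μ
    (Filter.Eventually.of_forall fun x ↦ ENNReal.toReal_nonneg) hf.ennreal_toReal.aemeasurable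
  simp only [ENNReal.ofReal_toReal (hfin _)] at h
  rw [h]
  refine setLIntegral_congr_fun measurableSet_Ioi fun s hs ↦ ?_
  simp only [ENNReal.ofReal_lt_iff_lt_toReal (le_of_lt hs) (hfin _)]

/-- An additive form of the one-dimensional Prékopa–Leindler inequality, for functions with
supremum one. -/
theorem lintegral_add_le_of_iSup_eq_one {p q : ℝ} (hp : 0 < p) (hq : 0 < q)
    {f g h : ℝ → ℝ≥0∞} (hf : Measurable f) (hg : Measurable g) (hh : Measurable h)
    (hf1 : ⨆ x, f x = 1) (hg1 : ⨆ x, g x = 1)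
    (H : ∀ x y, min (f x) (g y) ≤ h (p * x + q * y)) :
    ENNReal.ofReal p * (∫⁻ x, f x) + ENNReal.ofReal q * ∫⁻ x, g x ≤ ∫⁻ x, h x := by
  have hfle : ∀ x, f x ≤ 1 := fun x ↦ hf1 ▸ le_iSup f x
  have hgle : ∀ x, g x ≤ 1 := fun x ↦ hg1 ▸ le_iSup g x
  have hmeas : ∀ u : ℝ → ℝ≥0∞, Measurable fun s : ℝ ↦ volume {x | ENNReal.ofReal s < u x} :=
    fun u ↦ Antitone.measurable fun s t hst ↦
      measure_mono fun x hx ↦ (ENNReal.ofReal_le_ofReal hst).trans_lt hx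
  calc ENNReal.ofReal p * (∫⁻ x, f x) + ENNReal.ofReal q * ∫⁻ x, g x
      = ∫⁻ s in Set.Ioi (0 : ℝ), (ENNReal.ofReal p * volume {x | ENNReal.ofReal s < f x}
          + ENNReal.ofReal q * volume {x | ENNReal.ofReal s < g x}) := by
        rw [lintegral_add_left ((hmeas f).const_mul _), lintegral_const_mul _ (hmeas f),
          lintegral_const_mul _ (hmeas g), lintegral_eq_lintegral_meas_lt_of_le_one hf hfle,
          lintegral_eq_lintegral_meas_lt_of_le_one hg hgle]
    _ ≤ ∫⁻ s in Set.Ioi (0 : ℝ), volume {x | ENNReal.ofReal s < min (h x) 1} := by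
        refine lintegral_mono fun s ↦ ?_
        rcases lt_or_ge (ENNReal.ofReal s) 1 with hs | hs
        · obtain ⟨x, hx⟩ := lt_iSup_iff.1 (hf1 ▸ hs)
          obtain ⟨y, hy⟩ := lt_iSup_iff.1 (hg1 ▸ hs)
          have key : volume (p • {x | ENNReal.ofReal s < f x})
              + volume (q • {x | ENNReal.ofReal s < g x})
              ≤ volume (p • {x | ENNReal.ofReal s < f x}
                  + q • {x | ENNReal.ofReal s < g x}) :=
            ((measurableSet_lt measurable_const hf).const_smul₀ p).volume_add_volume_le_volume_add
              ((measurableSet_lt measurable_const hg).const_smul₀ q)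
              (Set.Nonempty.smul_set ⟨x, hx⟩) (Set.Nonempty.smul_set ⟨y, hy⟩)
          simp only [Measure.addHaar_smul, Module.finrank_self, pow_one, abs_of_pos hp,
            abs_of_pos hq] at key
          refine key.trans (measure_mono ?_)
          rintro _ ⟨_, ⟨x, hx, rfl⟩, _, ⟨y, hy, rfl⟩, rfl⟩
          exact lt_min ((lt_min hx hy).trans_le (H x y)) hs
        · simp [(hfle _).trans hs, (hgle _).trans hs, not_lt.2]
    _ = ∫⁻ x, min (h x) 1 :=
        (lintegral_eq_lintegral_meas_lt_of_le_one (hh.min measurable_const)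
          fun x ↦ min_le_right _ _).symm
    _ ≤ ∫⁻ x, h x := lintegral_mono fun x ↦ min_le_left _ _

theorem ENNReal.rpow_mul_rpow_le_add {p q : ℝ} (hp : 0 < p) (hq : 0 < q) (hpq : p + q = 1)
    (a b : ℝ≥0∞) : a ^ p * b ^ q ≤ ENNReal.ofReal p * a + ENNReal.ofReal q * b := by
  have h := ENNReal.young_inequality (a ^ p) (b ^ q) (p := p⁻¹) (q := q⁻¹)
    ⟨by simpa using hpq, by positivity, by positivity⟩
  rw [← ENNReal.rpow_mul, ← ENNReal.rpow_mul, mul_inv_cancel₀ hp.ne', mul_inv_cancel₀ hq.ne',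
    ENNReal.rpow_one, ENNReal.rpow_one, ENNReal.ofReal_inv_of_pos hp, ENNReal.ofReal_inv_of_pos hq,
    ENNReal.div_eq_inv_mul, ENNReal.div_eq_inv_mul, inv_inv, inv_inv] at h
  exact h

theorem ENNReal.min_le_rpow_mul_rpow {p q : ℝ} (hp : 0 < p) (hq : 0 < q) (hpq : p + q = 1)
    (a b : ℝ≥0∞) : min a b ≤ a ^ p * b ^ q :=
  calc min a b = min a b ^ p * min a b ^ q := by
        rw [← ENNReal.rpow_add_of_nonneg _ _ hp.le hq.le, hpq, ENNReal.rpow_one]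
    _ ≤ a ^ p * b ^ q := by gcongr <;> simp

/-- The one-dimensional Prékopa–Leindler inequality for bounded functions. -/
theorem prekopa_leindler_real_of_iSup_ne_top {p q : ℝ} (hp : 0 < p) (hq : 0 < q) (hpq : p + q = 1)
    {f g h : ℝ → ℝ≥0∞} (hf : Measurable f) (hg : Measurable g) (hh : Measurable h)
    (hf1 : ⨆ x, f x ≠ ∞) (hg1 : ⨆ x, g x ≠ ∞)
    (H : ∀ x y, f x ^ p * g y ^ q ≤ h (p * x + q * y)) :
    (∫⁻ x, f x) ^ p * (∫⁻ x, g x) ^ q ≤ ∫⁻ x, h x := by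
  set a := ⨆ x, f x
  set b := ⨆ x, g x
  by_cases ha : a = 0
  · have : ∀ x, f x = 0 := by simpa [a] using ha
    simp [this, hp]
  by_cases hb : b = 0
  · have : ∀ x, g x = 0 := by simpa [b] using hb
    simp [this, hq]
  have hap : a ^ p ≠ 0 ∧ a ^ p ≠ ∞ := by simp [ha, hf1, hp, hp.not_gt]
  have hbq : b ^ q ≠ 0 ∧ b ^ q ≠ ∞ := by simp [hb, hg1, hq, hq.not_gt]
  have hc : a ^ p * b ^ q ≠ 0 ∧ a ^ p * b ^ q ≠ ∞ :=
    ⟨mul_ne_zero hap.1 hbq.1, ENNReal.mul_ne_top hap.2 hbq.2⟩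
  have h1 := lintegral_add_le_of_iSup_eq_one hp hq (hf.const_mul a⁻¹) (hg.const_mul b⁻¹)
    (hh.const_mul (a ^ p * b ^ q)⁻¹) (by rw [← ENNReal.mul_iSup, ENNReal.inv_mul_cancel ha hf1])
    (by rw [← ENNReal.mul_iSup, ENNReal.inv_mul_cancel hb hg1]) fun x y ↦ by
      refine (ENNReal.min_le_rpow_mul_rpow hp hq hpq _ _).trans ?_
      rw [ENNReal.mul_rpow_of_nonneg _ _ hp.le, ENNReal.mul_rpow_of_nonneg _ _ hq.le,
        ENNReal.mul_inv (.inl hap.1) (.inl hap.2), ENNReal.inv_rpow, ENNReal.inv_rpow,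
        mul_mul_mul_comm]
      gcongr
      exact H x y
  rw [lintegral_const_mul _ hf, lintegral_const_mul _ hg, lintegral_const_mul _ hh] at h1
  have h2 := (ENNReal.rpow_mul_rpow_le_add hp hq hpq _ _).trans h1
  rw [ENNReal.mul_rpow_of_nonneg _ _ hp.le, ENNReal.mul_rpow_of_nonneg _ _ hq.le,
    mul_mul_mul_comm, ENNReal.inv_rpow, ENNReal.inv_rpow,
    ← ENNReal.mul_inv (.inl hap.1) (.inl hap.2)] at h2
  exact (ENNReal.mul_le_mul_iff_right (ENNReal.inv_ne_zero.2 hc.2) (ENNReal.inv_ne_top.2 hc.1)).1 h2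

theorem tendsto_lintegral_min_natCast {α : Type*} [MeasurableSpace α] {μ : Measure α}
    {f : α → ℝ≥0∞} (hf : Measurable f) :
    Filter.Tendsto (fun n : ℕ ↦ ∫⁻ x, min (f x) n ∂μ) Filter.atTop (nhds (∫⁻ x, f x ∂μ)) := by
  refine lintegral_tendsto_of_tendsto_of_monotone (fun n ↦ (hf.min measurable_const).aemeasurable)
    (.of_forall fun x m n hmn ↦ ?_) (.of_forall fun x ↦ ?_)
  · dsimp only
    gcongr
  · have : Filter.Tendsto (fun n : ℕ ↦ min (f x) n) Filter.atTop (nhds (min (f x) ∞)) :=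
      tendsto_const_nhds.min ENNReal.tendsto_nat_nhds_top
    simpa using this

/-- The one-dimensional Prékopa–Leindler inequality. -/
theorem prekopa_leindler_real {p q : ℝ} (hp : 0 < p) (hq : 0 < q) (hpq : p + q = 1)
    {f g h : ℝ → ℝ≥0∞} (hf : Measurable f) (hg : Measurable g) (hh : Measurable h)
    (H : ∀ x y, f x ^ p * g y ^ q ≤ h (p * x + q * y)) :
    (∫⁻ x, f x) ^ p * (∫⁻ x, g x) ^ q ≤ ∫⁻ x, h x := by
  by_cases hf0 : ∫⁻ x, f x = 0
  · simp [hf0, hp]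
  by_cases hg0 : ∫⁻ x, g x = 0
  · simp [hg0, hq]
  have hf' := (ENNReal.continuous_rpow_const (y := p)).tendsto _ |>.comp
    (tendsto_lintegral_min_natCast (μ := volume) hf)
  have hg' := (ENNReal.continuous_rpow_const (y := q)).tendsto _ |>.comp
    (tendsto_lintegral_min_natCast (μ := volume) hg)
  refine le_of_tendsto (ENNReal.Tendsto.mul hf' (.inl ?_) hg' (.inl ?_)) (.of_forall fun n ↦ ?_)
  · simp [hf0, hp.not_gt]
  · simp [hg0, hq.not_gt]
  · have hlt : ∀ u : ℝ → ℝ≥0∞, ⨆ x, min (u x) (n : ℝ≥0∞) ≠ ∞ := fun u ↦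
      ne_top_of_le_ne_top (ENNReal.natCast_ne_top n) (iSup_le fun x ↦ min_le_right _ _)
    refine prekopa_leindler_real_of_iSup_ne_top hp hq hpq (hf.min measurable_const)
      (hg.min measurable_const) hh (hlt f) (hlt g) fun x y ↦ le_trans ?_ (H x y)
    gcongr <;> exact min_le_left _ _

/-- The **Prékopa–Leindler inequality**. -/
theorem prekopa_leindler {p q : ℝ} (hp : 0 < p) (hq : 0 < q) (hpq : p + q = 1) {d : ℕ}
    {f g h : (Fin d → ℝ) → ℝ≥0∞} (hf : Measurable f) (hg : Measurable g) (hh : Measurable h)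
    (H : ∀ x y, f x ^ p * g y ^ q ≤ h (p • x + q • y)) :
    (∫⁻ x, f x) ^ p * (∫⁻ x, g x) ^ q ≤ ∫⁻ x, h x := by
  induction d with
  | zero =>
    have h1 : (volume : Measure (Fin 0 → ℝ)) Set.univ = 1 := by
      simp [volume_pi]
    simp only [lintegral_unique, h1, mul_one]
    exact (H _ _).trans_eq (congrArg h (Subsingleton.elim _ _))
  | succ d ih =>
    let e := (MeasurableEquiv.piFinSuccAbove (fun _ : Fin (d + 1) ↦ ℝ) 0).symm
    have he : MeasurePreserving e volume volume :=
      (volume_preserving_piFinSuccAbove (fun _ : Fin (d + 1) ↦ ℝ) 0).symm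
    have hint : ∀ u : (Fin (d + 1) → ℝ) → ℝ≥0∞, Measurable u →
        ∫⁻ x, u x = ∫⁻ s : ℝ, ∫⁻ y : Fin d → ℝ, u (e (s, y)) := fun u hu ↦ by
      rw [← he.lintegral_comp hu, Measure.volume_eq_prod,
        lintegral_prod (fun z ↦ u (e z)) (hu.comp e.measurable).aemeasurable]
    have hm : ∀ u : (Fin (d + 1) → ℝ) → ℝ≥0∞, Measurable u →
        Measurable fun s : ℝ ↦ ∫⁻ y : Fin d → ℝ, u (e (s, y)) := fun u hu ↦
      (hu.comp e.measurable).lintegral_prod_right'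
    have hs : ∀ u : (Fin (d + 1) → ℝ) → ℝ≥0∞, Measurable u → ∀ s,
        Measurable fun y : Fin d → ℝ ↦ u (e (s, y)) := fun u hu s ↦
      (hu.comp e.measurable).comp measurable_prodMk_left
    have hadd : ∀ s t y z, e (p * s + q * t, p • y + q • z) = p • e (s, y) + q • e (t, z) := by
      intro s t y z
      ext i
      refine Fin.cases ?_ (fun j ↦ ?_) i <;> simp [e, MeasurableEquiv.piFinSuccAbove]
    rw [hint f hf, hint g hg, hint h hh]
    refine prekopa_leindler_real hp hq hpq (hm f hf) (hm g hg) (hm h hh) fun s t ↦ ?_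
    refine ih (hs f hf s) (hs g hg t) (hs h hh _) fun y z ↦ ?_
    rw [hadd]
    exact H _ _

/-- The multiplicative **Brunn–Minkowski inequality**. -/
theorem volume_rpow_mul_volume_rpow_le {p q : ℝ} (hp : 0 < p) (hq : 0 < q) (hpq : p + q = 1)
    {d : ℕ} {A B : Set (Fin d → ℝ)} (hA : MeasurableSet A) (hB : MeasurableSet B)
    (hAB : MeasurableSet (p • A + q • B)) :
    volume A ^ p * volume B ^ q ≤ volume (p • A + q • B) := by
  have h := prekopa_leindler hp hq hpq (measurable_one.indicator hA) (measurable_one.indicator hB)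
    (measurable_one.indicator hAB) fun x y ↦ by
      by_cases hx : x ∈ A
      · by_cases hy : y ∈ B
        · rw [Set.indicator_of_mem (Set.add_mem_add (Set.smul_mem_smul_set hx)
            (Set.smul_mem_smul_set hy))]
          simp [hx, hy]
        · simp [hy, hq]
      · simp [hx, hp]
  rwa [lintegral_indicator_one hA, lintegral_indicator_one hB, lintegral_indicator_one hAB] at h

/-- The **Brunn–Minkowski inequality** for open sets. -/
theorem IsOpen.brunn_minkowski {d : ℕ} {A B : Set (Fin d → ℝ)} (hA : IsOpen A)
    (hB : IsOpen B) {a b : ℝ} (ha : 0 < a) (hb : 0 < b) (hvA : ENNReal.ofReal (a ^ d) ≤ volume A)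
    (hvB : ENNReal.ofReal (b ^ d) ≤ volume B) :
    ENNReal.ofReal ((a + b) ^ d) ≤ volume (A + B) := by
  have hab : 0 < a + b := by positivity
  have hp : 0 < a / (a + b) := by positivity
  have hq : 0 < b / (a + b) := by positivity
  have hpq : a / (a + b) + b / (a + b) = 1 := by field_simp
  have hset : (a / (a + b)) • a⁻¹ • A + (b / (a + b)) • b⁻¹ • B = (a + b)⁻¹ • (A + B) := by
    rw [smul_smul, smul_smul, smul_add]
    congr 2 <;> field_simp
  have hv : ∀ {r : ℝ} (s : Set (Fin d → ℝ)), 0 < r →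
      volume (r⁻¹ • s) = (ENNReal.ofReal (r ^ d))⁻¹ * volume s := by
    intro r s hr
    rw [Measure.addHaar_smul, Module.finrank_fin_fun, abs_of_pos (by positivity), inv_pow,
      ENNReal.ofReal_inv_of_pos (by positivity)]
  have hne : ∀ {r : ℝ}, 0 < r → ENNReal.ofReal (r ^ d) ≠ 0 := fun hr ↦ by
    simpa using pow_pos hr d
  have h := volume_rpow_mul_volume_rpow_le hp hq hpq (hA.measurableSet.const_smul₀ a⁻¹)
    (hB.measurableSet.const_smul₀ b⁻¹) (by
      rw [hset]; exact (hA.add_right).measurableSet.const_smul₀ _)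
  have hone : ∀ {r : ℝ} {s : Set (Fin d → ℝ)}, 0 < r → ENNReal.ofReal (r ^ d) ≤ volume s →
      1 ≤ volume (r⁻¹ • s) := by
    intro r s hr hs
    rw [hv _ hr, ← ENNReal.inv_mul_cancel (hne hr) ENNReal.ofReal_ne_top]
    gcongr
  rw [hset] at h
  have h1 : 1 ≤ volume ((a + b)⁻¹ • (A + B)) :=
    (one_le_mul (ENNReal.one_le_rpow (hone ha hvA) hp)
      (ENNReal.one_le_rpow (hone hb hvB) hq)).trans h
  rwa [hv _ hab, ← ENNReal.div_eq_inv_mul, ENNReal.le_div_iff_mul_le (.inl (hne hab))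
    (.inl ENNReal.ofReal_ne_top), one_mul] at h1

theorem Seminorm.continuous_of_pi {d : ℕ} (p : Seminorm ℝ (Fin d → ℝ)) : Continuous p :=
  p.convexOn.locallyLipschitz.continuous

theorem Seminorm.isOpen_ball_pi {d : ℕ} (p : Seminorm ℝ (Fin d → ℝ)) (x : Fin d → ℝ) (r : ℝ) :
    IsOpen (p.ball x r) :=
  isOpen_lt (p.continuous_of_pi.comp (continuous_id.sub continuous_const)) continuous_const

theorem Seminorm.volume_ball_zero {d : ℕ} (p : Seminorm ℝ (Fin d → ℝ)) {r : ℝ} (hr : 0 < r) :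
    volume (p.ball 0 r) = ENNReal.ofReal (r ^ d) * volume (p.ball 0 1) := by
  have h := Seminorm.smul_ball_zero (p := p) (r := 1) hr.ne'
  rw [Real.norm_of_nonneg hr.le, mul_one] at h
  rw [← h, Measure.addHaar_smul, Module.finrank_fin_fun, abs_of_pos (by positivity)]

/-- The Brunn–Minkowski inequality for an arbitrary set, equipped with the outer measure, and an
open ball of a seminorm. -/
theorem Seminorm.brunn_minkowski_ball {d : ℕ} (p : Seminorm ℝ (Fin d → ℝ)) {A : Set (Fin d → ℝ)}
    {a b ε : ℝ} (ha : 0 < a) (hb : 0 < b) (hε : 0 < ε) (hvA : ENNReal.ofReal (a ^ d) ≤ volume A)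
    (hvB : ENNReal.ofReal (b ^ d) ≤ volume (p.ball 0 1)) :
    ENNReal.ofReal ((a + ε * b) ^ d) ≤ volume (A + p.ball 0 ε) := by
  have key : ∀ r ∈ Set.Ioo 0 ε, ENNReal.ofReal ((a + r * b) ^ d) ≤ volume (A + p.ball 0 ε) := by
    rintro r ⟨hr, hrε⟩
    have hδ : 0 < ε - r := sub_pos.2 hrε
    have h1 : A ⊆ A + p.ball 0 (ε - r) := fun x hx ↦
      ⟨x, hx, 0, by simpa [Seminorm.mem_ball_zero] using hrε, by simp⟩
    have h2 : ENNReal.ofReal ((r * b) ^ d) ≤ volume (p.ball 0 r) := by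
      rw [p.volume_ball_zero hr, mul_pow, ENNReal.ofReal_mul (by positivity)]
      gcongr
    refine (IsOpen.brunn_minkowski (p.isOpen_ball_pi 0 (ε - r)).add_left (p.isOpen_ball_pi 0 r) ha
      (mul_pos hr hb) (hvA.trans (measure_mono h1)) h2).trans (measure_mono ?_)
    rw [add_assoc]
    refine Set.add_subset_add_left ((p.ball_add_ball_subset _ _ _ _).trans ?_)
    simp
  have hlim : Filter.Tendsto (fun r ↦ ENNReal.ofReal ((a + r * b) ^ d)) (nhdsWithin ε (Set.Iio ε))
      (nhds (ENNReal.ofReal ((a + ε * b) ^ d))) := by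
    refine Filter.Tendsto.mono_left (Continuous.tendsto ?_ ε) nhdsWithin_le_nhds
    exact ENNReal.continuous_ofReal.comp (by fun_prop)
  refine le_of_tendsto hlim ?_
  filter_upwards [Ioo_mem_nhdsLT hε] with r hr using key r hr

/-- The relative growth of a set of outer measure at most `m ^ d` when it is thickened by a
seminorm ball. -/
theorem Seminorm.mul_volume_le_volume_add_ball {d : ℕ} (hd : 0 < d)
    (p : Seminorm ℝ (Fin d → ℝ)) {A : Set (Fin d → ℝ)} {m b ε : ℝ} (hm : 0 < m) (hb : 0 < b)
    (hε : 0 < ε) (hA : volume A ≤ ENNReal.ofReal (m ^ d))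
    (hvB : ENNReal.ofReal (b ^ d) ≤ volume (p.ball 0 1)) :
    ENNReal.ofReal ((1 + ε * (b / m)) ^ d) * volume A ≤ volume (A + p.ball 0 ε) := by
  by_cases h0 : volume A = 0
  · simp [h0]
  have hfin : volume A ≠ ∞ := ne_top_of_le_ne_top ENNReal.ofReal_ne_top hA
  obtain ⟨a, ha, had⟩ : ∃ a : ℝ, 0 < a ∧ a ^ d = (volume A).toReal :=
    ⟨(volume A).toReal ^ (1 / (d : ℝ)), Real.rpow_pos_of_pos (ENNReal.toReal_pos h0 hfin) _, by
      rw [one_div, Real.rpow_inv_natCast_pow ENNReal.toReal_nonneg hd.ne']⟩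
  have hvA : volume A = ENNReal.ofReal (a ^ d) := by rw [had, ENNReal.ofReal_toReal hfin]
  have ham : a ≤ m := by
    rw [hvA, ENNReal.ofReal_le_ofReal_iff (by positivity)] at hA
    exact le_of_pow_le_pow_left₀ hd.ne' hm.le hA
  refine le_trans ?_ (p.brunn_minkowski_ball ha hb hε hvA.ge hvB)
  rw [hvA, ← ENNReal.ofReal_mul (by positivity), ← mul_pow]
  refine ENNReal.ofReal_le_ofReal (pow_le_pow_left₀ (by positivity) ?_ d)
  have h1 : a / m ≤ 1 := (div_le_one hm).2 ham
  calc (1 + ε * (b / m)) * a = a + ε * b * (a / m) := by ring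
    _ ≤ a + ε * b * 1 := by gcongr
    _ = a + ε * b := by ring

/-- If every ball of radius `ε` meets only finitely many members of a family of nonempty sets,
then the family is countable. -/
theorem Seminorm.countable_of_finite_ball {d : ℕ} (p : Seminorm ℝ (Fin d → ℝ))
    {P : Set (Set (Fin d → ℝ))} (hP : ∀ X ∈ P, X.Nonempty) {ε : ℝ} (hε : 0 < ε)
    (hfin : ∀ x, {X ∈ P | (X ∩ p.ball x ε).Nonempty}.Finite) : P.Countable := by
  obtain ⟨s, hs, hsd⟩ := TopologicalSpace.exists_countable_dense (Fin d → ℝ)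
  refine (hs.biUnion fun x _ ↦ (hfin x).countable).mono fun X hX ↦ ?_
  obtain ⟨y, hy⟩ := hP X hX
  obtain ⟨x, hx, hxs⟩ := hsd.inter_open_nonempty _ (p.isOpen_ball_pi y ε)
    ⟨y, by simpa [Seminorm.mem_ball] using hε⟩
  refine Set.mem_biUnion hxs ⟨hX, y, hy, ?_⟩
  rwa [Seminorm.mem_ball, map_sub_rev]

/-- A double counting bound: if every ball of radius `ε` meets at most `n` members of a countable
cover `P`, and thickening subsets of members by `ε` multiplies their measure by at least `L`,
then so does the thickening of any ball, up to the factor `n`. -/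
theorem Seminorm.mul_volume_ball_le {d : ℕ} (p : Seminorm ℝ (Fin d → ℝ))
    {P : Set (Set (Fin d → ℝ))} (hPc : P.Countable) (hPu : ⋃₀ P = Set.univ) {ε : ℝ} {n : ℕ}
    {L : ℝ≥0∞} (hn : ∀ x, ∀ s : Finset (Set (Fin d → ℝ)), ↑s ⊆ P →
      (∀ X ∈ s, (X ∩ p.ball x ε).Nonempty) → s.card ≤ n)
    (hL : ∀ X ∈ P, ∀ A ⊆ X, L * volume A ≤ volume (A + p.ball 0 ε)) (R : ℝ) :
    L * volume (p.ball 0 R) ≤ n * volume (p.ball 0 (R + ε)) := by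
  classical
  have := hPc.to_subtype
  let T : P → Set (Fin d → ℝ) := fun X ↦ (X.1 ∩ p.ball 0 R) + p.ball 0 ε
  have hT : ∀ X, MeasurableSet (T X) := fun X ↦ (p.isOpen_ball_pi 0 ε).add_left.measurableSet
  have hTsub : ∀ X, T X ⊆ p.ball 0 (R + ε) := fun X ↦
    (Set.add_subset_add_right Set.inter_subset_right).trans
      (by simpa using p.ball_add_ball_subset R ε 0 0)
  calc L * volume (p.ball 0 R) = L * volume (⋃ X : P, X.1 ∩ p.ball 0 R) := by
        rw [← Set.iUnion_inter, ← Set.sUnion_eq_iUnion, hPu, Set.univ_inter]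
    _ ≤ L * ∑' X : P, volume (X.1 ∩ p.ball 0 R) := by gcongr; exact measure_iUnion_le _
    _ = ∑' X : P, L * volume (X.1 ∩ p.ball 0 R) := ENNReal.tsum_mul_left.symm
    _ ≤ ∑' X : P, volume (T X) :=
        ENNReal.tsum_le_tsum fun X ↦ hL X.1 X.2 _ Set.inter_subset_left
    _ = ∫⁻ x, ∑' X : P, (T X).indicator 1 x := by
        rw [lintegral_tsum fun X ↦ (measurable_one.indicator (hT X)).aemeasurable]
        simp_rw [lintegral_indicator_one (hT _)]
    _ ≤ ∫⁻ x, (p.ball 0 (R + ε)).indicator (fun _ ↦ (n : ℝ≥0∞)) x := by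
        refine lintegral_mono fun x ↦ ?_
        by_cases hx : x ∈ p.ball 0 (R + ε)
        · rw [Set.indicator_of_mem hx, ENNReal.tsum_eq_iSup_sum]
          refine iSup_le fun s ↦ ?_
          simp only [Set.indicator_apply, Pi.one_apply, Finset.sum_boole, Nat.cast_le]
          rw [← Finset.card_map (Function.Embedding.subtype (· ∈ P))]
          refine hn x _ (by simp) ?_
          simp only [Finset.mem_map, Finset.mem_filter]
          rintro _ ⟨X, ⟨-, y, hy, z, hz, hyz⟩, rfl⟩
          refine ⟨y, hy.1, ?_⟩
          rw [Seminorm.mem_ball_zero] at hz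
          rwa [Seminorm.mem_ball, map_sub_rev, ← hyz, add_sub_cancel_left]
        · have : ∀ X, x ∉ T X := fun X h ↦ hx (hTsub X h)
          simp [this]
    _ = n * volume (p.ball 0 (R + ε)) :=
        lintegral_indicator_const (p.isOpen_ball_pi 0 _).measurableSet _

end

/-- ε-neighborhoods for measure-bounded partitions with respect to an arbitrary norm `N` on
`ℝ^d` (modeled as `Fin d → ℝ`): if every member of the partition `P` has outer Lebesgue measure
at most `M`, then for every `ε > 0` there is a point `p` whose open `N`-ball of radius `ε`
intersects at least `⌈(1 + ε (v/M)^(1/d))^d⌉` members of `P`, where `v` is the Lebesgue measure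
of the `N`-unit ball. -/
theorem neighborhood_lower_bound_measure_bounded_any_norm
    (d : ℕ) (hd : 0 < d) (M : ℝ) (hM : 0 < M)
    (N : (Fin d → ℝ) → ℝ)
    (hN0 : ∀ x, N x = 0 ↔ x = 0)
    (hN1 : ∀ (a : ℝ) (x : Fin d → ℝ), N (a • x) = |a| * N x)
    (hN2 : ∀ x y : Fin d → ℝ, N (x + y) ≤ N x + N y)
    (P : Set (Set (Fin d → ℝ))) (hP : Setoid.IsPartition P)
    (hmeas : ∀ X ∈ P, volume X ≤ ENNReal.ofReal M)
    (ε : ℝ) (hε : 0 < ε) :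
    ∃ p : Fin d → ℝ, ∃ 𝒮 : Finset (Set (Fin d → ℝ)),
      ↑𝒮 ⊆ P ∧
      ⌈(1 + ε * ((volume {x : Fin d → ℝ | N x < 1}).toReal / M) ^ (1 / (d : ℝ))) ^ d⌉₊
        ≤ 𝒮.card ∧
      ∀ X ∈ 𝒮, (X ∩ {x : Fin d → ℝ | N (x - p) < ε}).Nonempty := by
  let p : Seminorm ℝ (Fin d → ℝ) := Seminorm.of N hN2 hN1
  have hball : ∀ x r, {y | N (y - x) < r} = p.ball x r := fun x r ↦ rfl
  have hball0 : {x | N x < 1} = p.ball 0 1 := by rw [← hball]; simp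
  simp only [hball, hball0]
  have hPu := hP.sUnion_eq_univ
  set v := (volume (p.ball 0 1)).toReal with hv
  set m := M ^ (1 / (d : ℝ)) with hmdef
  have hm : 0 < m := Real.rpow_pos_of_pos hM _
  have hmd : m ^ d = M := by
    rw [hmdef, one_div, Real.rpow_inv_natCast_pow hM.le hd.ne']
  rw [Real.div_rpow ENNReal.toReal_nonneg hM.le, ← hmdef]
  set b := v ^ (1 / (d : ℝ)) with hbdef
  have hbd : b ^ d = v := by
    rw [hbdef, one_div, Real.rpow_inv_natCast_pow ENNReal.toReal_nonneg hd.ne']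
  have hb0 : 0 ≤ b := Real.rpow_nonneg ENNReal.toReal_nonneg _
  rcases hb0.eq_or_lt with hb | hb
  · obtain ⟨X, hX, h0X⟩ : (0 : Fin d → ℝ) ∈ ⋃₀ P := hPu ▸ Set.mem_univ _
    refine ⟨0, {X}, by simpa using hX, by simp [← hb], ?_⟩
    simpa using ⟨0, h0X, by simpa [Seminorm.mem_ball] using hε⟩
  have hv0 : 0 < v := hbd ▸ pow_pos hb d
  have hvol : volume (p.ball 0 1) = ENNReal.ofReal (b ^ d) := by
    rw [hbd, hv, ENNReal.ofReal_toReal (ENNReal.toReal_pos_iff.1 hv0).2.ne]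
  set L := (1 + ε * (b / m)) ^ d with hLdef
  have hL0 : 0 < L := by positivity
  by_contra! hcon
  obtain ⟨n, hn⟩ : ∃ n, ⌈L⌉₊ = n + 1 :=
    Nat.exists_eq_succ_of_ne_zero (Nat.ceil_pos.2 hL0).ne'
  have hcard : ∀ x, ∀ s : Finset (Set (Fin d → ℝ)), ↑s ⊆ P →
      (∀ X ∈ s, (X ∩ p.ball x ε).Nonempty) → s.card ≤ n := by
    intro x s hs h
    by_contra! hlt
    obtain ⟨X, hX, hX'⟩ := hcon x s hs (by omega)
    exact (h X hX).ne_empty hX'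
  have hfin : ∀ x, {X ∈ P | (X ∩ p.ball x ε).Nonempty}.Finite := by
    intro x
    by_contra hinf
    obtain ⟨s, hs, hsn⟩ := Set.Infinite.exists_subset_card_eq hinf (n + 1)
    have := hcard x s (fun X hX ↦ (hs hX).1) fun X hX ↦ (hs hX).2
    omega
  have hPc := p.countable_of_finite_ball (fun X hX ↦ Setoid.nonempty_of_mem_partition hP hX) hε hfin
  have hR : ∀ R : ℝ, 0 < R → L ≤ n * (1 + ε * R⁻¹) ^ d := by
    intro R hR
    have h := p.mul_volume_ball_le hPc hPu hcard (fun X hX A hA ↦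
      p.mul_volume_le_volume_add_ball hd hm hb hε
        ((measure_mono hA).trans (hmd ▸ hmeas X hX)) hvol.ge) R
    rw [p.volume_ball_zero hR, p.volume_ball_zero (add_pos hR hε), hvol,
      ← ENNReal.ofReal_natCast, ← ENNReal.ofReal_mul (by positivity),
      ← ENNReal.ofReal_mul (by positivity), ← ENNReal.ofReal_mul (by positivity),
      ← ENNReal.ofReal_mul (by positivity), ENNReal.ofReal_le_ofReal_iff (by positivity),
      ← mul_assoc, ← mul_assoc, mul_le_mul_iff_left₀ (by positivity)] at h
    have hsplit : R + ε = (1 + ε * R⁻¹) * R := by field_simp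
    rwa [hsplit, mul_pow, ← mul_assoc, mul_le_mul_iff_left₀ (by positivity)] at h
  have hlim : Filter.Tendsto (fun R : ℝ ↦ n * (1 + ε * R⁻¹) ^ d) Filter.atTop
      (nhds (n * (1 + ε * 0) ^ d)) :=
    (((tendsto_inv_atTop_zero.const_mul ε).const_add 1).pow d).const_mul _
  have hLn : L ≤ n := by
    simpa using ge_of_tendsto hlim ((Filter.eventually_gt_atTop 0).mono hR)
  have := Nat.ceil_le.2 hLn
  omega
end
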